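/- Let (s_k) be a sequence of positive integers in which every term s_k is a power of 2. Then for every n ≥ 1, the number of words of length n in L^{(s)} satisfies Set.ncard {w ∈ L^{(s)} : |w| = n} ≤ 8n. -/

import Mathlib

/-- The complement of a binary word: negate every letter. -/
def wordCompl (w : List Bool) : List Bool := w.map Bool.not

/-- `wordPow u k` is the concatenation of `k` copies of `u`. -/
def wordPow (u : List Bool) (k : ℕ) : List Bool := (List.replicate k u).flatten

/-- Pouzet's words `α_i^{(s)}`: `α_1 = [0,1]`, `α_{i+1} = α_i^{s_i} ++ ᾱ_i^{s_i}`. -/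
def alphaWord (s : ℕ → ℕ) : ℕ → List Bool
  | 0 => []
  | 1 => [false, true]
  | (i + 2) => wordPow (alphaWord s (i + 1)) (s (i + 1)) ++
      wordPow (wordCompl (alphaWord s (i + 1))) (s (i + 1))

/-- The language `L^{(s)}` of all factors of the words `α_i^{(s)}`, `i ≥ 1`. -/
def langL (s : ℕ → ℕ) : Set (List Bool) :=
  {w | ∃ i, 1 ≤ i ∧ w <:+: alphaWord s i}


def blk (β : List Bool) (b : Bool) : List Bool := if b then wordCompl β else β

def Dec (β w : List Bool) : Prop := ∃ L : List Bool, w = (L.map (blk β)).flatten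

theorem wordCompl_append (u v : List Bool) :
    wordCompl (u ++ v) = wordCompl u ++ wordCompl v := by simp [wordCompl]

theorem wordCompl_compl (u : List Bool) : wordCompl (wordCompl u) = u := by
  simp [wordCompl, Function.comp_def]

theorem wordCompl_length (u : List Bool) : (wordCompl u).length = u.length := by
  simp [wordCompl]

theorem wordPow_length (u : List Bool) (k : ℕ) : (wordPow u k).length = k * u.length := by
  simp [wordPow]

theorem wordPow_succ (u : List Bool) (k : ℕ) : wordPow u (k + 1) = u ++ wordPow u k := by
  simp [wordPow, List.replicate_succ]

theorem wordPow_zero (u : List Bool) : wordPow u 0 = [] := by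
  simp [wordPow]

theorem wordPow_add (u : List Bool) (a b : ℕ) :
    wordPow u (a + b) = wordPow u a ++ wordPow u b := by
  rw [wordPow, wordPow, wordPow, List.replicate_add, List.flatten_append]

theorem blk_length (β : List Bool) (b : Bool) : (blk β b).length = β.length := by
  cases b <;> simp [blk, wordCompl_length]

theorem blk_not (β : List Bool) (b : Bool) : wordCompl (blk β b) = blk β (!b) := by
  cases b <;> simp [blk, wordCompl_compl]

theorem Dec.self (β : List Bool) : Dec β β := ⟨[false], by simp [blk]⟩

theorem Dec.append {β u v : List Bool} (hu : Dec β u) (hv : Dec β v) : Dec β (u ++ v) := by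
  obtain ⟨L, rfl⟩ := hu
  obtain ⟨M, rfl⟩ := hv
  exact ⟨L ++ M, by simp⟩

theorem Dec.pow {β u : List Bool} (hu : Dec β u) (k : ℕ) : Dec β (wordPow u k) := by
  induction k with
  | zero => exact ⟨[], by simp [wordPow]⟩
  | succ k ih => rw [wordPow_succ]; exact hu.append ih

theorem Dec.compl {β u : List Bool} (hu : Dec β u) : Dec β (wordCompl u) := by
  obtain ⟨L, rfl⟩ := hu
  refine ⟨L.map Bool.not, ?_⟩
  induction L with
  | nil => simp [wordCompl]
  | cons b L ih =>
    simp only [List.map_cons, List.flatten_cons, wordCompl_append, blk_not, ih]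

theorem Dec.powMul {β : List Bool} (u : List Bool) (a : ℕ) (hu : Dec β (wordPow u a)) (b : ℕ) :
    Dec β (wordPow u (a * b)) := by
  induction b with
  | zero => exact ⟨[], by simp [wordPow]⟩
  | succ b ih => rw [Nat.mul_succ, wordPow_add]; exact ih.append hu

theorem alphaWord_succ (s : ℕ → ℕ) (i : ℕ) (hi : 1 ≤ i) :
    alphaWord s (i + 1) = wordPow (alphaWord s i) (s i) ++
      wordPow (wordCompl (alphaWord s i)) (s i) := by
  obtain ⟨j, rfl⟩ : ∃ j, i = j + 1 := ⟨i - 1, by omega⟩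
  rfl

theorem alpha_dec_mono (s : ℕ → ℕ) (β : List Bool) (i : ℕ) (hi : 1 ≤ i)
    (h : Dec β (wordPow (alphaWord s i) (s i))) (hc : Dec β (wordPow (wordCompl (alphaWord s i)) (s i)))
    (j : ℕ) (hj : i + 1 ≤ j) : Dec β (alphaWord s j) := by
  induction j, hj using Nat.le_induction with
  | base => rw [alphaWord_succ s i hi]; exact h.append hc
  | succ j hj ih =>
    rw [alphaWord_succ s j (by omega)]
    exact (ih.pow _).append (ih.compl.pow _)

theorem exists_block (s : ℕ → ℕ) (hs : ∀ k, ∃ m : ℕ, s k = 2 ^ m) (k : ℕ) (hk : 1 ≤ k) :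
    ∃ i m, 1 ≤ i ∧ 2 ^ m ∣ s i ∧ 2 ^ m * (alphaWord s i).length = 2 ^ k := by
  induction k, hk using Nat.le_induction with
  | base => exact ⟨1, 0, le_rfl, by simp, by simp [alphaWord]⟩
  | succ k hk ih =>
    obtain ⟨i, m, hi, hm, hl⟩ := ih
    obtain ⟨M, hM⟩ := hs i
    rw [hM] at hm
    have hmM : m ≤ M := (Nat.pow_dvd_pow_iff_le_right (by norm_num)).1 hm
    rcases Nat.lt_or_ge m M with h | h
    · refine ⟨i, m + 1, hi, ?_, ?_⟩
      · rw [hM]; exact pow_dvd_pow 2 h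
      · rw [pow_succ, pow_succ, ← hl]; ring
    · have : m = M := by omega
      subst this
      refine ⟨i + 1, 0, by omega, by simp, ?_⟩
      rw [alphaWord_succ s i hi, List.length_append, wordPow_length, wordPow_length,
        wordCompl_length, hM, pow_succ, ← hl]
      ring

theorem wordPow_compl (u : List Bool) (k : ℕ) :
    wordPow (wordCompl u) k = wordCompl (wordPow u k) := by
  simp [wordPow, wordCompl]

theorem exists_dec (s : ℕ → ℕ) (hs : ∀ k, ∃ m : ℕ, s k = 2 ^ m) (k : ℕ) (hk : 1 ≤ k) :
    ∃ β : List Bool, β.length = 2 ^ k ∧ ∃ i, ∀ j, i ≤ j → Dec β (alphaWord s j) := by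
  obtain ⟨i, m, hi, ⟨c, hc⟩, hl⟩ := exists_block s hs k hk
  refine ⟨wordPow (alphaWord s i) (2 ^ m), by rw [wordPow_length, hl], i + 1, ?_⟩
  have h : Dec (wordPow (alphaWord s i) (2 ^ m)) (wordPow (alphaWord s i) (s i)) := by
    rw [hc]; exact Dec.powMul _ _ (Dec.self _) _
  refine alpha_dec_mono s _ i hi h ?_
  rw [wordPow_compl]; exact h.compl

theorem alpha_infix (s : ℕ → ℕ) (hs : ∀ k, ∃ m : ℕ, s k = 2 ^ m) (i : ℕ) (hi : 1 ≤ i) (j : ℕ)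
    (hj : i ≤ j) : alphaWord s i <:+: alphaWord s j := by
  induction j, hj using Nat.le_induction with
  | base => exact List.infix_refl _
  | succ j hj ih =>
    refine ih.trans ?_
    obtain ⟨M, hM⟩ := hs j
    have hpos : 0 < 2 ^ M := by positivity
    obtain ⟨c, hc⟩ : ∃ c, s j = c + 1 := ⟨s j - 1, by omega⟩
    rw [alphaWord_succ s j (by omega), hc, wordPow_succ, List.append_assoc]
    exact (List.prefix_append _ _).isInfix

theorem factor_form (β : List Bool) (n : ℕ) (hn : 1 ≤ n) (hp : n ≤ β.length) (L : List Bool) :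
    ∀ a u b : List Bool, u.length = n → a ++ u ++ b = (L.map (blk β)).flatten →
      ∃ x y : Bool, ∃ o < β.length, u = ((blk β x ++ blk β y).drop o).take n := by
  induction L with
  | nil =>
    intro a u b hu h
    have := congrArg List.length h
    simp at this
    simp [this] at hu
    omega
  | cons x L ih =>
    intro a u b hu h
    have hbx := blk_length β x
    rcases Nat.lt_or_ge a.length β.length with hq | hq
    · have key : u = (((blk β x ++ (L.map (blk β)).flatten)).drop a.length).take n := by
        rw [List.map_cons, List.flatten_cons] at h
        rw [← h, ← hu]
        simp
      cases L with
      | nil =>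
        refine ⟨x, x, a.length, hq, ?_⟩
        have hle := congrArg List.length h
        simp only [List.map_cons, List.flatten_cons, List.map_nil, List.flatten_nil,
          List.length_append, List.length_nil] at hle
        rw [key]
        rw [List.drop_append_of_le_length (by omega), List.drop_append_of_le_length (by omega),
          List.take_append_of_le_length (by simp; omega),
          List.take_append_of_le_length (by simp; omega)]
      | cons y L =>
        refine ⟨x, y, a.length, hq, ?_⟩
        have hby := blk_length β y
        rw [key, List.map_cons, List.flatten_cons, ← List.append_assoc,
          List.drop_append_of_le_length (by simp; omega),
          List.take_append_of_le_length (by simp; omega)]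
    · refine ih (a.drop β.length) u b hu ?_
      have := congrArg (List.drop β.length) h
      rw [List.map_cons, List.flatten_cons, ← hbx, List.drop_left, hbx, List.append_assoc,
        List.drop_append_of_le_length hq] at this
      rw [← this, List.append_assoc]

theorem langL_linear_complexity_of_powers_of_two (s : ℕ → ℕ)
    (hs : ∀ k, ∃ m : ℕ, s k = 2 ^ m) (n : ℕ) (hn : 1 ≤ n) :
    Set.ncard {w ∈ langL s | w.length = n} ≤ 8 * n := by
  obtain ⟨β, hβ, i, hi⟩ := exists_dec s hs (Nat.log 2 n + 1) (by omega)
  have h1 : n < 2 ^ (Nat.log 2 n + 1) := Nat.lt_pow_succ_log_self (by norm_num) n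
  have h2 : 2 ^ (Nat.log 2 n + 1) ≤ 2 * n := by
    have := Nat.pow_log_le_self 2 (x := n) (by omega)
    rw [pow_succ]; omega
  let f : Bool × Bool × Fin β.length → List Bool :=
    fun t => ((blk β t.1 ++ blk β t.2.1).drop t.2.2).take n
  have hsub : {w ∈ langL s | w.length = n} ⊆ f '' Set.univ := by
    rintro w ⟨⟨j, hj, hw⟩, hl⟩
    obtain ⟨L, hL⟩ := hi (max i j) (le_max_left _ _)
    obtain ⟨a, b, hab⟩ := hw.trans (alpha_infix s hs j hj (max i j) (le_max_right _ _))
    obtain ⟨x, y, o, ho, hu⟩ := factor_form β n hn (by omega) L a w b hl (hab.trans hL)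
    exact ⟨(x, y, ⟨o, ho⟩), trivial, hu.symm⟩
  have h3 := Set.ncard_le_ncard hsub (Set.toFinite _)
  have h4 := Set.ncard_image_le (f := f) (s := Set.univ) (Set.toFinite _)
  rw [Set.ncard_univ, Nat.card_eq_fintype_card] at h4
  simp only [Fintype.card_prod, Fintype.card_bool, Fintype.card_fin] at h4
  omega
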